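/- arXiv:2308.02376 — 4 statements merged into one kernel-verified Lean document; each statement's English description precedes it below -/
import Mathlib

section
/- Kato's inequality: For any N ∈ ℕ, a ∈ ℝ and b ∈ ℝ⁺ with b > |a|, the probability that S_N − Λ_N ≥ [b + a(2Λ_N/N − 1)]√N is at most exp[−2(b² − a²) / (1 + 4a/(3√N))²]. -/
open MeasureTheory Finset

/-- the squared term -/
noncomputable def kX (s c : ℝ) : ℝ := s * (1 + 2 * c) / (3 * c) - 6 * (c - 1) / (1 + 2 * c)

noncomputable def kw (c : ℝ) : ℝ := 3 * c * (1 - c) ^ 2 * (1 + 8 * c) / (1 + 2 * c) ^ 3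

noncomputable def kG (s A c : ℝ) : ℝ := kX s c ^ 2 / 8 - A / c + 1 - Real.log c + Real.log A

noncomputable def kK (s A c : ℝ) : ℝ :=
  (1 - c) / (3 * c) * (s ^ 2 / 12 - kw c) + (1 + s / 2 + s ^ 2 / 12 - A)

lemma kG_deriv (s A c : ℝ) (hc : 0 < c) : HasDerivAt (kG s A) (-(1 / c ^ 2) * kK s A c) c := by
  have h1 : HasDerivAt (fun c : ℝ => s * (1 + 2 * c) / (3 * c))
      ((s * 2 * (3 * c) - s * (1 + 2 * c) * 3) / (3 * c) ^ 2) c := by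
    have hn : HasDerivAt (fun c : ℝ => s * (1 + 2 * c)) (s * 2) c := by
      simpa using (((hasDerivAt_id c).const_mul 2).const_add 1).const_mul s
    have hd : HasDerivAt (fun c : ℝ => 3 * c) 3 c := by
      simpa using (hasDerivAt_id c).const_mul 3
    exact hn.div hd (by positivity)
  have h2 : HasDerivAt (fun c : ℝ => 6 * (c - 1) / (1 + 2 * c))
      ((6 * (1 + 2 * c) - 6 * (c - 1) * 2) / (1 + 2 * c) ^ 2) c := by
    have hn : HasDerivAt (fun c : ℝ => 6 * (c - 1)) 6 c := by
      simpa using ((hasDerivAt_id c).sub_const 1).const_mul 6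
    have hd : HasDerivAt (fun c : ℝ => 1 + 2 * c) 2 c := by
      simpa using ((hasDerivAt_id c).const_mul 2).const_add 1
    exact hn.div hd (by positivity)
  have h3 := ((h1.sub h2).pow 2).div_const 8
  have h4 : HasDerivAt (fun c : ℝ => A / c) (-A / c ^ 2) c := by
    have := (hasDerivAt_const c A).div (hasDerivAt_id c) hc.ne'
    refine HasDerivAt.congr_deriv (f' := _) this ?_
    simp
  have h5 := (((h3.sub h4).add_const 1).sub (Real.hasDerivAt_log hc.ne')).add_const (Real.log A)
  refine HasDerivAt.congr_deriv (f' := _) h5 ?_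
  simp only [kK, kw, Pi.sub_apply]
  push_cast
  field_simp
  ring

lemma kw_deriv (c : ℝ) (hc : 0 < c) : HasDerivAt kw
    (3 * (1 - c) * (1 - 4 * c) * (1 + 13 * c + 4 * c ^ 2) / (1 + 2 * c) ^ 4) c := by
  have e1 : HasDerivAt (fun c : ℝ => 3 * c) 3 c := by
    simpa using (hasDerivAt_id c).const_mul 3
  have e2 : HasDerivAt (fun c : ℝ => 1 - c) (-1) c := by
    simpa using (hasDerivAt_id c).const_sub 1
  have e3 : HasDerivAt (fun c : ℝ => 1 + 8 * c) 8 c := by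
    simpa using ((hasDerivAt_id c).const_mul 8).const_add 1
  have e4 : HasDerivAt (fun c : ℝ => 1 + 2 * c) 2 c := by
    simpa using ((hasDerivAt_id c).const_mul 2).const_add 1
  have := ((e1.mul (e2.pow 2)).mul e3).div (e4.pow 3)
    (ne_of_gt (show (0 : ℝ) < (1 + 2 * c) ^ 3 by positivity))
  refine HasDerivAt.congr_deriv (f' := _) this ?_
  simp only [Pi.mul_apply, Pi.pow_apply]
  push_cast
  field_simp
  ring

lemma mono_aux (f f' : ℝ → ℝ) (x y : ℝ) (hxy : x ≤ y) (hd : ∀ z ∈ Set.Icc x y, HasDerivAt f (f' z) z)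
    (hp : ∀ z ∈ Set.Icc x y, 0 ≤ f' z) : f x ≤ f y := by
  have : MonotoneOn f (Set.Icc x y) := by
    apply monotoneOn_of_hasDerivWithinAt_nonneg (f' := f') (convex_Icc x y)
    · exact fun z hz => (hd z hz).continuousAt.continuousWithinAt
    · exact fun z hz => (hd z (interior_subset hz)).hasDerivWithinAt
    · exact fun z hz => hp z (interior_subset hz)
  exact this ⟨le_rfl, hxy⟩ ⟨hxy, le_rfl⟩ hxy

lemma anti_aux (f f' : ℝ → ℝ) (x y : ℝ) (hxy : x ≤ y) (hd : ∀ z ∈ Set.Icc x y, HasDerivAt f (f' z) z)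
    (hp : ∀ z ∈ Set.Icc x y, f' z ≤ 0) : f y ≤ f x := by
  have := mono_aux (fun z => - f z) (fun z => - f' z) x y hxy (fun z hz => (hd z hz).neg)
    (fun z hz => by linarith [hp z hz])
  linarith

lemma kw_mono {x y : ℝ} (hx : 1 ≤ x) (hxy : x ≤ y) : kw x ≤ kw y := by
  refine mono_aux kw _ x y hxy (fun z hz => kw_deriv z (by linarith [hz.1])) ?_
  intro z hz
  have h1 : 1 ≤ z := hx.trans hz.1
  have : 0 ≤ (1 - z) * (1 - 4 * z) := by nlinarith
  have h3 : 0 ≤ 3 * (1 - z) * (1 - 4 * z) := by linarith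
  positivity

lemma kw_anti {x y : ℝ} (hx : 1 / 4 ≤ x) (hxy : x ≤ y) (hy : y ≤ 1) : kw y ≤ kw x := by
  refine anti_aux kw _ x y hxy (fun z hz => kw_deriv z (by linarith [hz.1])) ?_
  intro z hz
  have h1 : 1 / 4 ≤ z := hx.trans hz.1
  have h2 : z ≤ 1 := hz.2.trans hy
  have : (1 - z) * (1 - 4 * z) ≤ 0 := by nlinarith
  have h3 : 3 * (1 - z) * (1 - 4 * z) ≤ 0 := by linarith
  apply div_nonpos_of_nonpos_of_nonneg
  · apply mul_nonpos_of_nonpos_of_nonneg h3; nlinarith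
  · positivity

lemma kw_le {x : ℝ} (hx : 0 < x) (hx1 : x ≤ 1) : kw x ≤ 3 / 8 := by
  have e : kw (1 / 4) = 3 / 8 := by norm_num [kw]
  rw [← e]
  rcases le_total x (1 / 4) with h | h
  · refine mono_aux kw _ x (1 / 4) h (fun z hz => kw_deriv z (by linarith [hz.1])) ?_
    intro z hz
    have h1 : 0 < z := hx.trans_le hz.1
    have h2 : 0 ≤ 1 - z := by linarith [hz.2]
    have h3 : 0 ≤ 1 - 4 * z := by linarith [hz.2]
    positivity
  · exact kw_anti le_rfl h hx1

lemma kG_one (s A : ℝ) (hs : 0 ≤ s) (hA1 : 1 ≤ A) (hA : A ≤ 1 + s / 2 + s ^ 2 / 12) :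
    0 ≤ kG s A 1 := by
  have key : s / 2 - s ^ 2 / 24 ≤ Real.log (1 + s / 2 + s ^ 2 / 12) := by
    have := mono_aux (fun x : ℝ => Real.log (1 + x / 2 + x ^ 2 / 12) - (x / 2 - x ^ 2 / 24))
      (fun x => (1 / 2 + 2 * x / 12) / (1 + x / 2 + x ^ 2 / 12) - (1 / 2 - 2 * x / 24)) 0 s hs
      (fun z hz => by
        have hz0 := hz.1
        have a1 : HasDerivAt (fun x : ℝ => x / 2) (1 / 2) z := (hasDerivAt_id z).div_const 2
        have a2 : ∀ k : ℝ, HasDerivAt (fun x : ℝ => x ^ 2 / k) (2 * z / k) z := fun k => by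
          simpa using (hasDerivAt_pow 2 z).div_const k
        exact (((a1.const_add 1).add (a2 12)).log
          (ne_of_gt (show (0 : ℝ) < 1 + z / 2 + z ^ 2 / 12 by positivity))).sub (a1.sub (a2 24)))
      (fun z hz => by
        have hz0 := hz.1
        have : (1 / 2 + 2 * z / 12) / (1 + z / 2 + z ^ 2 / 12) - (1 / 2 - 2 * z / 24)
          = (z ^ 3 / 144) / (1 + z / 2 + z ^ 2 / 12) := by
          field_simp
          ring
        rw [this]; positivity)
    simp at this
    linarith
  have h2 : Real.log (1 + s / 2 + s ^ 2 / 12) - Real.log A ≤ (1 + s / 2 + s ^ 2 / 12) - A := by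
    have hA0 : 0 < A := by linarith
    rw [← Real.log_div (by positivity) hA0.ne']
    have := Real.log_le_sub_one_of_pos (x := (1 + s / 2 + s ^ 2 / 12) / A) (by positivity)
    refine this.trans ?_
    rw [div_sub_one hA0.ne']
    exact div_le_self (by linarith) hA1
  have e : kX s 1 = s := by simp [kX]; ring
  simp only [kG, e, Real.log_one]
  linarith

lemma exp_pade (s : ℝ) (hs : 0 ≤ s) :
    s ^ 2 + 6 * s + 12 ≤ Real.exp s * (s ^ 2 - 6 * s + 12) := by
  have p1 : ∀ z : ℝ, HasDerivAt (fun x : ℝ => x ^ 2) (2 * z) z := fun z => by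
    simpa using (hasDerivAt_pow 2 z)
  have i : ∀ k z : ℝ, HasDerivAt (fun x : ℝ => k * x) k z := fun k z => by
    simpa using (hasDerivAt_id z).const_mul k
  have h1 : ∀ s : ℝ, 0 ≤ s → 0 ≤ Real.exp s * (s ^ 2 - 2 * s + 2) - 2 := fun s hs => by
    have := mono_aux (fun x : ℝ => Real.exp x * (x ^ 2 - 2 * x + 2) - 2) 
      (fun x => Real.exp x * (x ^ 2 - 2 * x + 2) + Real.exp x * (2 * x - 2)) 0 s hs
      (fun z hz => (((Real.hasDerivAt_exp z).mul (((p1 z).sub (i 2 z)).add_const 2)).sub_const 2))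
      (fun z hz => by
        have : Real.exp z * (z ^ 2 - 2 * z + 2) + Real.exp z * (2 * z - 2) = Real.exp z * z ^ 2 := by
          ring
        rw [this]; positivity)
    simpa using this
  have h2 : ∀ s : ℝ, 0 ≤ s → 0 ≤ Real.exp s * (s ^ 2 - 4 * s + 6) - 2 * s - 6 := fun s hs => by
    have := mono_aux (fun x : ℝ => Real.exp x * (x ^ 2 - 4 * x + 6) - 2 * x - 6) 
      (fun x => Real.exp x * (x ^ 2 - 4 * x + 6) + Real.exp x * (2 * x - 4) - 2) 0 s hs
      (fun z hz => ((((Real.hasDerivAt_exp z).mul (((p1 z).sub (i 4 z)).add_const 6)).sub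
        (i 2 z)).sub_const 6))
      (fun z hz => by linarith [h1 z hz.1])
    simpa using this
  have := mono_aux (fun x : ℝ => Real.exp x * (x ^ 2 - 6 * x + 12) - x ^ 2 - 6 * x - 12) 
      (fun x => Real.exp x * (x ^ 2 - 6 * x + 12) + Real.exp x * (2 * x - 6) - 2 * x - 6) 0 s hs
      (fun z hz => (((((Real.hasDerivAt_exp z).mul (((p1 z).sub (i 6 z)).add_const 12)).sub
        (p1 z)).sub (i 6 z)).sub_const 12))
      (fun z hz => by linarith [h2 z hz.1])
  simp at this
  linarith

lemma c0_le (s : ℝ) (hs : 0 < s) : s / (1 - Real.exp (-s)) ≤ 1 + s / 2 + s ^ 2 / 12 := by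
  have h1 : Real.exp (-s) < 1 := by simpa using hs
  rw [div_le_iff₀ (by linarith)]
  have h2 := exp_pade s hs.le
  have h3 : Real.exp (-s) * Real.exp s = 1 := by rw [← Real.exp_add]; simp
  have h4 := mul_le_mul_of_nonneg_left h2 (Real.exp_pos (-s)).le
  rw [← mul_assoc, h3] at h4
  nlinarith

lemma le_c0 (s : ℝ) (hs : 0 < s) : 1 ≤ s / (1 - Real.exp (-s)) := by
  have h1 : Real.exp (-s) < 1 := by simpa using hs
  rw [le_div_iff₀ (by linarith)]
  linarith [Real.add_one_le_exp (-s)]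

lemma quarter (s : ℝ) (hs : 0 < s) (hs2 : s ^ 2 ≤ 9 / 2) : 1 / 4 ≤ s / (Real.exp s - 1) := by
  have h1 : 1 < Real.exp s := by simpa using hs
  rw [le_div_iff₀ (by linarith)]
  have hs3 : s ≤ 11 / 5 := by nlinarith
  have he : Real.exp (11 / 5) ≤ 9.8 := by
    have : Real.exp (11 / 5) ^ 5 ≤ 9.8 ^ 5 := by
      rw [← Real.exp_nat_mul]
      have : ((5 : ℕ) : ℝ) * (11 / 5) = (11 : ℕ) * 1 := by norm_num
      rw [this, Real.exp_nat_mul]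
      have := Real.exp_one_lt_d9.le
      calc Real.exp 1 ^ 11 ≤ 2.7182818286 ^ 11 := by gcongr
        _ ≤ _ := by norm_num
    exact le_of_pow_le_pow_left₀ (by norm_num) (by norm_num) this
  have hc := convexOn_exp.2 (Set.mem_univ 0) (Set.mem_univ (11 / 5 : ℝ)) 
    (show 0 ≤ 1 - s / (11 / 5) by rw [sub_nonneg, div_le_one] <;> linarith)
    (show 0 ≤ s / (11 / 5) by positivity) (by ring)
  simp only [smul_eq_mul, Real.exp_zero, mul_zero, zero_add] at hc
  rw [div_mul_cancel₀ _ (by norm_num)] at hc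
  have : s / (11 / 5) * Real.exp (11 / 5) ≤ s / (11 / 5) * 9.8 := by gcongr
  linarith

lemma kG_ge_one (s A c : ℝ) (hs : 0 < s) (hA : A = 1 + s / 2 + s ^ 2 / 12) (hc : 1 ≤ c) (hcA : c ≤ A) :
    0 ≤ kG s A c := by
  have hA1 : 1 ≤ A := hc.trans hcA
  have hK : ∀ z, kK s A z = (1 - z) / (3 * z) * (s ^ 2 / 12 - kw z) := fun z => by
    rw [kK, ← hA]; ring
  rcases le_total (kw c) (s ^ 2 / 12) with h | h
  · refine (kG_one s A hs.le hA1 hA.le).trans ?_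
    refine mono_aux _ _ 1 c hc (fun z hz => kG_deriv s A z (by linarith [hz.1])) ?_
    intro z hz
    have hw := kw_mono hz.1 hz.2
    have hz1 := hz.1
    have : -(1 / z ^ 2) * kK s A z = (1 / z ^ 2) * ((z - 1) / (3 * z) * (s ^ 2 / 12 - kw z)) := by
      rw [hK]; ring
    rw [this]
    have h1 : 0 ≤ z - 1 := by linarith
    have h2 : 0 ≤ s ^ 2 / 12 - kw z := by linarith
    have h3 : 0 < z := by linarith
    positivity
  · have h0 : 0 ≤ kG s A A := by
      have : A / A = 1 := div_self (by linarith)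
      rw [kG, this]
      have := sq_nonneg (kX s A)
      linarith
    refine h0.trans ?_
    refine anti_aux _ _ c A hcA (fun z hz => kG_deriv s A z (by linarith [hz.1])) ?_
    intro z hz
    have hw := kw_mono hc hz.1
    have hz1 := hz.1
    have : -(1 / z ^ 2) * kK s A z = - ((1 / z ^ 2) * ((z - 1) / (3 * z) * (kw z - s ^ 2 / 12))) := by
      rw [hK]; ring
    rw [this, neg_nonpos]
    have h1 : 0 ≤ z - 1 := by linarith
    have h2 : 0 ≤ kw z - s ^ 2 / 12 := by linarith
    have h3 : 0 < z := by linarith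
    positivity

lemma kG_le_one (s A c : ℝ) (hs : 0 < s) (hA : A = s / (1 - Real.exp (-s))) (hc : c ≤ 1)
    (hcA : s / (Real.exp s - 1) ≤ c) : 0 ≤ kG s A c := by
  have hA1 : 1 ≤ A := hA ▸ le_c0 s hs
  have hA2 := c0_le s hs
  rw [← hA] at hA2
  have hE : 1 < Real.exp s := by simpa using hs
  have hc1 : 0 < s / (Real.exp s - 1) := div_pos hs (by linarith)
  have hc0 := hc1.trans_le hcA
  rcases le_or_gt 0 (kK s A c) with h | h
  · refine (kG_one s A hs.le hA1 hA2).trans ?_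
    refine anti_aux _ _ c 1 hc (fun z hz => kG_deriv s A z (by linarith [hz.1])) ?_
    intro z hz
    have hz0 : 0 < z := by linarith [hz.1]
    suffices 0 ≤ kK s A z by
      have h1 : 0 ≤ 1 / z ^ 2 * kK s A z := by positivity
      linarith
    have hu : 0 ≤ (1 - z) / (3 * z) := div_nonneg (by linarith [hz.2]) (by positivity)
    rcases le_total (kw z) (s ^ 2 / 12) with h' | h'
    · have := mul_nonneg hu (sub_nonneg.2 h')
      rw [kK]; linarith
    have hs2 : s ^ 2 ≤ 9 / 2 := by linarith [kw_le hz0 hz.2]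
    have hw := kw_anti ((quarter s hs hs2).trans hcA) hz.1 hz.2
    have huu : (1 - z) / (3 * z) ≤ (1 - c) / (3 * c) := by
      rw [div_le_div_iff₀ (by positivity) (by positivity)]; nlinarith [hz.1]
    have := mul_le_mul huu (show kw z - s ^ 2 / 12 ≤ kw c - s ^ 2 / 12 by linarith) (by linarith) (hu.trans huu)
    rw [kK] at h ⊢
    linarith
  · have h0 : 0 ≤ kG s A (s / (Real.exp s - 1)) := by
      set d := s / (Real.exp s - 1) with hd
      have hAd : A = d * Real.exp s := by
        rw [hA, hd, Real.exp_neg]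
        have : Real.exp s - 1 ≠ 0 := by linarith
        have : 1 - (Real.exp s)⁻¹ ≠ 0 := by
          rw [ne_eq, sub_eq_zero, eq_comm, inv_eq_one]; exact hE.ne'
        field_simp
      have hl : Real.log A = Real.log d + s := by
        rw [hAd, Real.log_mul hc1.ne' (Real.exp_pos s).ne', Real.log_exp]
      have hdiv : A / d = 1 + s / d := by
        rw [hAd, mul_div_cancel_left₀ _ hc1.ne', hd, div_div_cancel₀ hs.ne']; ring
      have : kG s A d = (s * (1 + 2 * d) / (3 * d) + 6 * (d - 1) / (1 + 2 * d)) ^ 2 / 8 := by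
        rw [kG, hl, hdiv, kX]
        field_simp
        ring
      rw [this]; positivity
    refine h0.trans ?_
    refine mono_aux _ _ _ c hcA (fun z hz => kG_deriv s A z (by linarith [hz.1])) ?_
    intro z hz
    have hz0 : 0 < z := by linarith [hz.1]
    suffices kK s A z ≤ 0 by
      have h1 : 0 ≤ 1 / z ^ 2 * (- kK s A z) := mul_nonneg (by positivity) (by linarith)
      linarith
    have hu : 0 ≤ (1 - c) / (3 * c) := div_nonneg (by linarith [hz.2]) (by positivity)
    have h' : s ^ 2 / 12 ≤ kw c := by
      by_contra! hh
      have := mul_nonneg hu (sub_nonneg.2 hh.le)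
      rw [kK] at h; linarith
    have hs2 : s ^ 2 ≤ 9 / 2 := by linarith [kw_le hc0 hc]
    have hw := kw_anti ((quarter s hs hs2).trans hz.1) hz.2 hc
    have huu : (1 - c) / (3 * c) ≤ (1 - z) / (3 * z) := by
      rw [div_le_div_iff₀ (by positivity) (by positivity)]; nlinarith [hz.2]
    have := mul_le_mul huu (show kw c - s ^ 2 / 12 ≤ kw z - s ^ 2 / 12 by linarith) (by linarith) (hu.trans huu)
    rw [kK] at h ⊢
    linarith

lemma key_ineq (s c p : ℝ) (hs : 0 < s) (hc : 0 < c) (hp0 : 0 ≤ p) (hp1 : p ≤ 1) :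
    Real.exp (s / c * p) * (1 - p * (1 - Real.exp (-s))) ≤ Real.exp (kX s c ^ 2 / 8) := by
  have hq0 : Real.exp (-s) < 1 := by simpa using hs
  have hE : 1 < Real.exp s := by simpa using hs
  have hee : Real.exp (-s) * Real.exp s = 1 := by rw [← Real.exp_add]; simp
  set q := 1 - Real.exp (-s) with hq
  have hqp : 0 < q := by linarith
  have hq1 : q < 1 := by linarith [Real.exp_pos (-s)]
  have hpos : 0 < 1 - p * q := by nlinarith
  suffices s / c * p + Real.log (1 - p * q) ≤ kX s c ^ 2 / 8 by
    calc _ = Real.exp (s / c * p + Real.log (1 - p * q)) := by rw [Real.exp_add, Real.exp_log hpos]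
      _ ≤ _ := Real.exp_le_exp.2 this
  set A0 := s / q with hA0
  have hA0p : 0 < A0 := by positivity
  -- case c ≥ A0
  rcases le_total A0 c with h | h
  · have h1 : s / c ≤ q := by
      rw [div_le_iff₀ hc]; rw [hA0, div_le_iff₀ hqp] at h; linarith
    have := Real.log_le_sub_one_of_pos hpos
    have : s / c * p ≤ q * p := by gcongr
    have : 0 ≤ kX s c ^ 2 / 8 := by positivity
    linarith
  rcases le_total c (s / (Real.exp s - 1)) with h' | h'
  · have ht : Real.exp s - 1 ≤ s / c := by
      rw [le_div_iff₀ hc]; rw [le_div_iff₀ (by linarith)] at h'; linarith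
    have e1 : 1 - p * q = Real.exp (-s) * (1 + (1 - p) * (Real.exp s - 1)) := by
      rw [hq]; linear_combination (p - 1) * hee
    have hpos2 : 0 < 1 + (1 - p) * (Real.exp s - 1) := by nlinarith
    rw [e1, Real.log_mul (Real.exp_pos _).ne' hpos2.ne', Real.log_exp]
    have h1 := Real.log_le_sub_one_of_pos hpos2
    have h2 : (1 - p) * (Real.exp s - 1) ≤ (1 - p) * (s / c) := by
      gcongr
    have h3 : kX s c ^ 2 / 8 =
      (s * (1 + 2 * c) / (3 * c) + 6 * (c - 1) / (1 + 2 * c)) ^ 2 / 8 + s / c - s := by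
      rw [kX]; field_simp; ring
    have : 0 ≤ (s * (1 + 2 * c) / (3 * c) + 6 * (c - 1) / (1 + 2 * c)) ^ 2 / 8 := by positivity
    linarith
  -- middle
  have hG : ∀ A, A0 ≤ A → 0 ≤ kG s A c → s / c * p + Real.log (1 - p * q) ≤ kX s c ^ 2 / 8 := by
    intro A hA hG
    have hAp : 0 < A := by linarith
    have h1 := Real.log_le_sub_one_of_pos (x := (1 - p * q) * (A0 / c)) (by positivity)
    rw [Real.log_mul hpos.ne' (by positivity), Real.log_div hA0p.ne' hc.ne'] at h1
    have h2 : (1 - p * q) * (A0 / c) = A0 / c - s / c * p := by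
      rw [hA0]; field_simp
    have h3 := Real.log_le_sub_one_of_pos (x := A / A0) (by positivity)
    rw [Real.log_div hAp.ne' hA0p.ne'] at h3
    have h4 : A / A0 - 1 ≤ A / c - A0 / c := by
      rw [← sub_div, div_sub_one hA0p.ne']
      exact div_le_div_of_nonneg_left (by linarith) hc h
    rw [kG] at hG
    linarith
  rcases le_total c 1 with hc1 | hc1
  · exact hG A0 le_rfl (kG_le_one s A0 c hs rfl hc1 h')
  · have := c0_le s hs
    exact hG _ this (kG_ge_one s _ c hs rfl hc1 (h.trans this))

lemma kato_mgf {Ω : Type*} {m0 : MeasurableSpace Ω} {μ : Measure Ω} [IsProbabilityMeasure μ]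
    (ξ : ℕ → Ω → ℝ) (hξ01 : ∀ u ω, ξ u ω = 0 ∨ ξ u ω = 1)
    (𝔉 : Filtration ℕ m0)
    (hint : ∀ v, Integrable (ξ v) μ)
    (hp : ∀ u, ∀ᵐ ω ∂μ, 0 ≤ (μ[ξ u | 𝔉 (u - 1)]) ω ∧ (μ[ξ u | 𝔉 (u - 1)]) ω ≤ 1)
    (hmart : ∀ v u, v ≤ u → μ[ξ v | 𝔉 u] =ᵐ[μ] ξ v)
    (s t R : ℝ) (hs : 0 < s) (ht : 0 ≤ t)
    (hR : ∀ p : ℝ, 0 ≤ p → p ≤ 1 → Real.exp (t * p) * (1 - p * (1 - Real.exp (-s))) ≤ Real.exp R)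
    (n : ℕ) :
    AEStronglyMeasurable[𝔉 n] (fun ω => Real.exp (∑ u ∈ Icc 1 n,
        (t * (μ[ξ u | 𝔉 (u - 1)]) ω - s * ξ u ω))) μ ∧
    Integrable (fun ω => Real.exp (∑ u ∈ Icc 1 n,
        (t * (μ[ξ u | 𝔉 (u - 1)]) ω - s * ξ u ω))) μ ∧
    ∫ ω, Real.exp (∑ u ∈ Icc 1 n, (t * (μ[ξ u | 𝔉 (u - 1)]) ω - s * ξ u ω)) ∂μ
      ≤ Real.exp (n * R) := by
  have hmeas : ∀ n, AEStronglyMeasurable[𝔉 n] (fun ω => ∑ u ∈ Icc 1 n,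
        (t * (μ[ξ u | 𝔉 (u - 1)]) ω - s * ξ u ω)) μ := by
    intro n
    refine ⟨fun ω => ∑ u ∈ Icc 1 n, (t * (μ[ξ u | 𝔉 (u - 1)]) ω - s * (μ[ξ u | 𝔉 n]) ω), ?_, ?_⟩
    · refine Finset.stronglyMeasurable_fun_sum _ fun u hu => ?_
      have hu' := (Finset.mem_Icc.1 hu).2
      refine StronglyMeasurable.sub ?_ ?_
      · exact (stronglyMeasurable_condExp.mono (𝔉.mono (by omega))).const_mul t
      · exact stronglyMeasurable_condExp.const_mul s
    · have : ∀ᵐ ω ∂μ, ∀ u ∈ Icc 1 n, (μ[ξ u | 𝔉 n]) ω = ξ u ω := by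
        rw [Filter.eventually_all_finset]
        intro u hu
        exact hmart u n (Finset.mem_Icc.1 hu).2
      filter_upwards [this] with ω hω
      exact Finset.sum_congr rfl fun u hu => by rw [hω u hu]
  have hmeasE : ∀ n, AEStronglyMeasurable[𝔉 n] (fun ω => Real.exp (∑ u ∈ Icc 1 n,
        (t * (μ[ξ u | 𝔉 (u - 1)]) ω - s * ξ u ω))) μ := fun n =>
    Real.continuous_exp.comp_aestronglyMeasurable (hmeas n)
  refine ⟨hmeasE n, ?_⟩
  have hI : ∀ n, Integrable (fun ω => Real.exp (∑ u ∈ Icc 1 n,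
        (t * (μ[ξ u | 𝔉 (u - 1)]) ω - s * ξ u ω))) μ := by
    intro n
    refine Integrable.of_bound ((hmeasE n).mono (𝔉.le n)) (Real.exp (∑ u ∈ Icc 1 n, t)) ?_
    filter_upwards [ae_all_iff.2 hp] with ω hω
    rw [Real.norm_of_nonneg (Real.exp_pos _).le]
    refine Real.exp_le_exp.2 (Finset.sum_le_sum fun u _ => ?_)
    have h1 := mul_le_mul_of_nonneg_left (hω u).2 ht
    have h2 : 0 ≤ ξ u ω := by rcases hξ01 u ω with h | h <;> rw [h] <;> norm_num
    nlinarith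
  refine ⟨hI n, ?_⟩
  induction n with
  | zero => simp
  | succ n ih =>
    set q := 1 - Real.exp (-s) with hq
    set M : Ω → ℝ := fun ω => Real.exp (∑ u ∈ Icc 1 n,
        (t * (μ[ξ u | 𝔉 (u - 1)]) ω - s * ξ u ω)) with hM
    set P : Ω → ℝ := μ[ξ (n + 1) | 𝔉 n] with hP
    have hPn : ∀ᵐ ω ∂μ, 0 ≤ P ω ∧ P ω ≤ 1 := hp (n + 1)
    set f : Ω → ℝ := fun ω => M ω * Real.exp (t * P ω) with hf
    have hPm : StronglyMeasurable[𝔉 n] (fun ω => Real.exp (t * P ω)) :=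
      Real.continuous_exp.comp_stronglyMeasurable (stronglyMeasurable_condExp.const_mul t)
    have hfm : AEStronglyMeasurable[𝔉 n] f μ := (hmeasE n).mul hPm.aestronglyMeasurable
    have hfi : Integrable f μ := by
      refine (hI n).mul_bdd (c := Real.exp t) (hPm.mono (𝔉.le n)).aestronglyMeasurable ?_
      filter_upwards [hPn] with ω hω
      rw [Real.norm_of_nonneg (Real.exp_pos _).le]
      exact Real.exp_le_exp.2 (by nlinarith [hω.2])
    have hfx : Integrable (f * ξ (n + 1)) μ := by
      refine hfi.mul_bdd (c := 1) (hint _).aestronglyMeasurable (ae_of_all _ fun ω => ?_)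
      rcases hξ01 (n + 1) ω with h | h <;> rw [h] <;> norm_num
    have hpull := condExp_mul_of_aestronglyMeasurable_left hfm hfx (hint (n + 1))
    have hfP : Integrable (f * P) μ := integrable_condExp.congr hpull
    have heq : ∫ ω, (f * ξ (n + 1)) ω ∂μ = ∫ ω, (f * P) ω ∂μ := by
      rw [← integral_condExp (𝔉.le n)]
      exact integral_congr_ae hpull
    have hstep : ∀ ω, Real.exp (∑ u ∈ Icc 1 (n + 1), (t * (μ[ξ u | 𝔉 (u - 1)]) ω - s * ξ u ω))
        = f ω - q * (f * ξ (n + 1)) ω := by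
      intro ω
      rw [Finset.sum_Icc_succ_top (by omega), Real.exp_add, sub_eq_add_neg, Real.exp_add]
      simp only [Nat.add_sub_cancel, Pi.mul_apply, hf]
      rcases hξ01 (n + 1) ω with h | h
      · rw [h]; simp [hM, hP]
      · rw [h, hq]; simp only [hM, hP, mul_one]; ring
    calc _ = ∫ ω, (f ω - q * (f * ξ (n + 1)) ω) ∂μ := integral_congr_ae (ae_of_all _ hstep)
      _ = ∫ ω, f ω ∂μ - q * ∫ ω, (f * P) ω ∂μ := by
        rw [integral_sub hfi (hfx.const_mul q), integral_const_mul, heq]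
      _ = ∫ ω, (f ω - q * (f * P) ω) ∂μ := by
        rw [integral_sub hfi (hfP.const_mul q), integral_const_mul]
      _ ≤ ∫ ω, M ω * Real.exp R ∂μ := by
        refine integral_mono_ae (hfi.sub (hfP.const_mul q)) ((hI n).mul_const _) ?_
        filter_upwards [hPn] with ω hω
        have := mul_le_mul_of_nonneg_left (hR (P ω) hω.1 hω.2) (Real.exp_pos (∑ u ∈ Icc 1 n,
          (t * (μ[ξ u | 𝔉 (u - 1)]) ω - s * ξ u ω))).le
        simp only [Pi.mul_apply, hf, hM]
        linarith
      _ = (∫ ω, M ω ∂μ) * Real.exp R := integral_mul_const _ _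
      _ ≤ Real.exp (n * R) * Real.exp R := by gcongr
      _ = _ := by rw [← Real.exp_add]; congr 1; push_cast; ring

/-- Kato's inequality (Eq. (33) of the paper): for Bernoulli random variables
`ξ_1, …, ξ_N` adapted to a filtration `𝔉` (in the sense that `E(ξ_v | 𝔉_u) = ξ_v`
a.s. for `v ≤ u`), with `Λ_N = ∑_{u=1}^N ξ_u` and
`S_N = ∑_{u=1}^N Pr(ξ_u = 1 | 𝔉_{u-1}) = ∑_{u=1}^N E(ξ_u | 𝔉_{u-1})`, and any
`a ∈ ℝ`, `b > 0` with `b > |a|`, the probability that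
`S_N - Λ_N ≥ (b + a(2Λ_N/N - 1))√N` is at most
`exp(-2(b² - a²)/(1 + 4a/(3√N))²)`. -/
theorem kato_inequality
    {Ω : Type*} {m0 : MeasurableSpace Ω} {μ : Measure Ω} [IsProbabilityMeasure μ]
    (N : ℕ) (hN : 0 < N)
    (ξ : ℕ → Ω → ℝ) (hξ01 : ∀ u ω, ξ u ω = 0 ∨ ξ u ω = 1)
    (𝔉 : Filtration ℕ m0)
    (hmart : ∀ v u, v ≤ u → μ[ξ v | 𝔉 u] =ᵐ[μ] ξ v)
    (a b : ℝ) (hb : 0 < b) (hba : b > |a|) :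
    μ {ω | (∑ u ∈ Icc 1 N, (μ[ξ u | 𝔉 (u - 1)]) ω) - (∑ u ∈ Icc 1 N, ξ u ω)
        ≥ (b + a * (2 * (∑ u ∈ Icc 1 N, ξ u ω) / N - 1)) * Real.sqrt N}
      ≤ ENNReal.ofReal
          (Real.exp (-2 * (b ^ 2 - a ^ 2) / (1 + 4 * a / (3 * Real.sqrt N)) ^ 2)) := by
  have hint : ∀ v, Integrable (ξ v) μ := by
    intro v
    by_contra h
    have h1 := hmart v v le_rfl
    rw [condExp_of_not_integrable h] at h1
    exact h ((integrable_zero Ω ℝ μ).congr h1)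
  have hx0 : ∀ u ω, 0 ≤ ξ u ω := fun u ω => by
    rcases hξ01 u ω with h | h <;> rw [h] <;> norm_num
  have hx1 : ∀ u ω, ξ u ω ≤ 1 := fun u ω => by
    rcases hξ01 u ω with h | h <;> rw [h] <;> norm_num
  have hp : ∀ u, ∀ᵐ ω ∂μ, 0 ≤ (μ[ξ u | 𝔉 (u - 1)]) ω ∧ (μ[ξ u | 𝔉 (u - 1)]) ω ≤ 1 := by
    intro u
    have h1 := condExp_nonneg (m := 𝔉 (u - 1)) (ae_of_all μ (hx0 u))
    have h2 := condExp_mono (m := 𝔉 (u - 1)) (hint u) (integrable_const (1 : ℝ))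
      (ae_of_all μ (hx1 u))
    rw [condExp_const (𝔉.le _)] at h2
    filter_upwards [h1, h2] with ω h1 h2
    exact ⟨h1, h2⟩
  have hNr : (0 : ℝ) < N := by exact_mod_cast hN
  set r := Real.sqrt N with hr
  have hr0 : 0 < r := Real.sqrt_pos.2 hNr
  have hrr : r ^ 2 = N := Real.sq_sqrt hNr.le
  have hNr2 : (N : ℝ) = r ^ 2 := hrr.symm
  have hab := abs_lt.1 hba
  set c := 1 + 2 * a / r with hc
  have hev : ∀ ω, ((∑ u ∈ Icc 1 N, (μ[ξ u | 𝔉 (u - 1)]) ω) - (∑ u ∈ Icc 1 N, ξ u ω)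
        ≥ (b + a * (2 * (∑ u ∈ Icc 1 N, ξ u ω) / N - 1)) * r) ↔
      (b - a) * r ≤ (∑ u ∈ Icc 1 N, (μ[ξ u | 𝔉 (u - 1)]) ω) - c * (∑ u ∈ Icc 1 N, ξ u ω) := by
    intro ω
    have : (b + a * (2 * (∑ u ∈ Icc 1 N, ξ u ω) / N - 1)) * r
        = (b - a) * r + (c - 1) * (∑ u ∈ Icc 1 N, ξ u ω) := by
      rw [hNr2, hc]; field_simp; ring
    rw [this]
    constructor <;> intro h <;> linarith
  simp only [hev]
  rcases le_or_gt c 0 with hc0 | hc0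
  · -- the event is null
    have : μ {ω | (b - a) * r ≤ (∑ u ∈ Icc 1 N, (μ[ξ u | 𝔉 (u - 1)]) ω)
        - c * (∑ u ∈ Icc 1 N, ξ u ω)} = 0 := by
      rw [measure_eq_zero_iff_ae_notMem]
      filter_upwards [ae_all_iff.2 hp] with ω hω
      simp only [Set.mem_setOf_eq, not_le]
      have h1 : ∑ u ∈ Icc 1 N, (μ[ξ u | 𝔉 (u - 1)]) ω ≤ N := by
        calc _ ≤ ∑ u ∈ Icc 1 N, (1 : ℝ) := Finset.sum_le_sum fun u _ => (hω u).2
          _ = N := by simp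
      have h2 : ∑ u ∈ Icc 1 N, ξ u ω ≤ N := by
        calc _ ≤ ∑ u ∈ Icc 1 N, (1 : ℝ) := Finset.sum_le_sum fun u _ => hx1 u ω
          _ = N := by simp
      have h3 : c * N = r ^ 2 + 2 * a * r := by rw [hNr2, hc]; field_simp
      nlinarith
    rw [this]; exact zero_le
  set D := 1 + 4 * a / (3 * r) with hD
  have hDc : D = (1 + 2 * c) / 3 := by rw [hD, hc]; field_simp; ring
  have hD0 : 0 < D := by rw [hDc]; positivity
  set t := 4 * (b / r) / D ^ 2 with ht
  have ht0 : 0 < t := by positivity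
  have hR : ∀ p : ℝ, 0 ≤ p → p ≤ 1 →
      Real.exp (t * p) * (1 - p * (1 - Real.exp (-(t * c)))) ≤ Real.exp (kX (t * c) c ^ 2 / 8) := by
    intro p h0 h1
    have := key_ineq (t * c) c p (by positivity) hc0 h0 h1
    rwa [mul_div_cancel_right₀ _ hc0.ne'] at this
  obtain ⟨-, hI, hE⟩ := kato_mgf ξ hξ01 𝔉 hint hp hmart (t * c) t _ (by positivity) ht0.le hR N
  have hsum : ∀ ω, ∑ u ∈ Icc 1 N, (t * (μ[ξ u | 𝔉 (u - 1)]) ω - t * c * ξ u ω) =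
      t * ((∑ u ∈ Icc 1 N, (μ[ξ u | 𝔉 (u - 1)]) ω) - c * (∑ u ∈ Icc 1 N, ξ u ω)) := by
    intro ω
    rw [Finset.sum_sub_distrib, ← Finset.mul_sum, ← Finset.mul_sum]; ring
  simp only [hsum] at hI hE
  have hch := ProbabilityTheory.measure_ge_le_exp_mul_mgf (μ := μ) ((b - a) * r) ht0.le hI
  rw [← ofReal_measureReal]
  refine ENNReal.ofReal_le_ofReal (hch.trans ?_)
  calc _ ≤ Real.exp (-t * ((b - a) * r)) * Real.exp (N * (kX (t * c) c ^ 2 / 8)) := by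
        gcongr; exact hE
    _ = _ := by
      rw [← Real.exp_add]
      congr 1
      have ha : a = (c - 1) * r / 2 := by rw [hc]; field_simp; ring
      rw [ht, kX, hDc, hNr2, ha]
      field_simp
      ring
end

section
/- Optimal parameters for the direct Kato lower bound: Let N ∈ ℕ, ε ∈ (0,1), and Λ̃ ∈ (0,N) be a guess. Then the pair (a,b) with a = 3{9√2·N(N − 2Λ̃)·√(−ln ε·[9Λ̃(N − Λ̃) − 2N ln ε]) + 16N^{3/2} ln²ε − 72Λ̃√N(N − Λ̃) ln ε} / (4(9N − 8 ln ε)[9Λ̃(N − Λ̃) − 2N ln ε]) and b = √(18Na² − (16a² − 24√N·a + 9N) ln ε) / (3√(2N)) minimizes the objective [b + a(2Λ̃/N − 1)]√N over all (a,b) ∈ ℝ × ℝ⁺ satisfying exp[−2(b² − a²)/(1 − 4a/(3√N))²] = ε and b ≥ |a|. -/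
/-- Algebraic core: stationarity and the quadratic constraint. -/
lemma kato_core (s L l D q r a b0 : ℝ) (hs : 0 < s) (hL : 0 < L)
    (hD : D = 9 * l * (s ^ 2 - l) + 2 * s ^ 2 * L) (hDpos : 0 < D)
    (hq : q ^ 2 = 2) (hr : r ^ 2 = L * D)
    (ha : a = 3 * (9 * q * s ^ 2 * (s ^ 2 - 2 * l) * r + 8 * s * L * D)
      / (4 * (9 * s ^ 2 + 8 * L) * D))
    (hb : b0 = 3 * s ^ 2 * q * r / (4 * D)) :
    a - 2 * L / (3 * s) * (1 - 4 * a / (3 * s)) = -(2 * l / s ^ 2 - 1) * b0 ∧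
    b0 ^ 2 = a ^ 2 + L / 2 * (1 - 4 * a / (3 * s)) ^ 2 := by
  have h1 : 0 < 9 * s ^ 2 + 8 * L := by positivity
  have E : a - 2 * L / (3 * s) * (1 - 4 * a / (3 * s)) = -(2 * l / s ^ 2 - 1) * b0 := by
    rw [ha, hb]
    field_simp
    ring
  refine ⟨E, ?_⟩
  have hb2 : b0 ^ 2 = 9 * s ^ 4 * L / (8 * D) := by
    have : b0 ^ 2 = 9 * s ^ 4 * q ^ 2 * r ^ 2 / (16 * D ^ 2) := by rw [hb]; field_simp; ring
    rw [this, hq, hr]; field_simp; ring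
  set A : ℝ := 1 + 8 * L / (9 * s ^ 2) with hA
  have hApos : 0 < A := by positivity
  have E' : A * a - 2 * L / (3 * s) = -(2 * l / s ^ 2 - 1) * b0 := by
    rw [← E, hA]; field_simp; ring
  have hb3 : (A - (2 * l / s ^ 2 - 1) ^ 2) * b0 ^ 2 = L / 2 := by
    have : A - (2 * l / s ^ 2 - 1) ^ 2 = 4 * D / (9 * s ^ 4) := by
      rw [hA, hD]; field_simp; ring
    rw [this, hb2]; field_simp; ring
  have key : A * (b0 ^ 2) = A * (a ^ 2 + L / 2 * (1 - 4 * a / (3 * s)) ^ 2) := by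
    have e1 : A * (a ^ 2 + L / 2 * (1 - 4 * a / (3 * s)) ^ 2)
        = (A * a - 2 * L / (3 * s)) ^ 2 + L / 2 := by
      rw [hA]; field_simp; ring
    rw [e1, E']; linarith [hb3]
  exact mul_left_cancel₀ hApos.ne' key

/-- Optimal parameters for the direct Kato lower bound (Eqs. (35)-(36) of the paper):
for `N ∈ ℕ`, `ε ∈ (0,1)` and a guess `Λ̃ ∈ (0,N)`, the explicitly given pair `(a,b)`
is feasible for the constraint `exp(-2(b² - a²)/(1 - 4a/(3√N))²) = ε`, `b ≥ |a|`,
`b > 0`, and minimizes the deviation term `(b + a(2Λ̃/N - 1))√N` among all feasible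
pairs. -/
theorem direct_kato_lower_optimal_parameters
    (N : ℕ) (hN : 0 < N) (ε : ℝ) (hε : ε ∈ Set.Ioo (0 : ℝ) 1)
    (Λ : ℝ) (hΛ : Λ ∈ Set.Ioo (0 : ℝ) (N : ℝ)) (a b : ℝ)
    (ha : a = 3 * (9 * Real.sqrt 2 * (N : ℝ) * ((N : ℝ) - 2 * Λ) *
          Real.sqrt (-Real.log ε * (9 * Λ * ((N : ℝ) - Λ) - 2 * (N : ℝ) * Real.log ε))
        + 16 * Real.sqrt (N : ℝ) ^ 3 * Real.log ε ^ 2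
        - 72 * Λ * Real.sqrt (N : ℝ) * ((N : ℝ) - Λ) * Real.log ε)
      / (4 * (9 * (N : ℝ) - 8 * Real.log ε) *
          (9 * Λ * ((N : ℝ) - Λ) - 2 * (N : ℝ) * Real.log ε)))
    (hb : b = Real.sqrt (18 * (N : ℝ) * a ^ 2
          - (16 * a ^ 2 - 24 * Real.sqrt (N : ℝ) * a + 9 * (N : ℝ)) * Real.log ε)
      / (3 * Real.sqrt (2 * (N : ℝ)))) :
    (0 < b ∧ b ≥ |a| ∧
      Real.exp (-2 * (b ^ 2 - a ^ 2) / (1 - 4 * a / (3 * Real.sqrt (N : ℝ))) ^ 2) = ε) ∧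
    ∀ a' b' : ℝ, 0 < b' → b' ≥ |a'| →
      Real.exp (-2 * (b' ^ 2 - a' ^ 2) / (1 - 4 * a' / (3 * Real.sqrt (N : ℝ))) ^ 2) = ε →
      (b + a * (2 * Λ / (N : ℝ) - 1)) * Real.sqrt (N : ℝ)
        ≤ (b' + a' * (2 * Λ / (N : ℝ) - 1)) * Real.sqrt (N : ℝ) := by
  obtain ⟨hε0, hε1⟩ := hε
  obtain ⟨hΛ0, hΛ1⟩ := hΛ
  have hlog : Real.log ε < 0 := Real.log_neg hε0 hε1
  have hn : (0 : ℝ) < N := by exact_mod_cast hN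
  obtain ⟨s, hs_def⟩ : ∃ s, s = Real.sqrt (N : ℝ) := ⟨_, rfl⟩
  have hs : 0 < s := by rw [hs_def]; exact Real.sqrt_pos.mpr hn
  have hNs : (N : ℝ) = s ^ 2 := by rw [hs_def, Real.sq_sqrt hn.le]
  obtain ⟨L, hLdef⟩ : ∃ L, L = -Real.log ε := ⟨_, rfl⟩
  have hL : 0 < L := by linarith
  have hlogL : Real.log ε = -L := by linarith
  rw [← hs_def] at ha hb ⊢
  rw [hlogL] at ha hb
  rw [hNs] at ha hb hΛ1 ⊢
  obtain ⟨D, hD⟩ : ∃ D, D = 9 * Λ * (s ^ 2 - Λ) + 2 * s ^ 2 * L := ⟨_, rfl⟩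
  have hpm : 0 < Λ * (s ^ 2 - Λ) := mul_pos hΛ0 (by linarith)
  have hDpos : 0 < D := by
    have : 0 < s ^ 2 * L := by positivity
    rw [hD]; nlinarith
  have hD1 : 9 * Λ * (s ^ 2 - Λ) - 2 * s ^ 2 * -L = D := by rw [hD]; ring
  have hD2 : 9 * s ^ 2 - 8 * -L = 9 * s ^ 2 + 8 * L := by ring
  rw [hD1, neg_neg, hD2] at ha
  have hq : Real.sqrt 2 ^ 2 = 2 := Real.sq_sqrt (by norm_num)
  have hqpos : 0 < Real.sqrt 2 := Real.sqrt_pos.mpr (by norm_num)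
  have hr : Real.sqrt (L * D) ^ 2 = L * D := Real.sq_sqrt (by positivity)
  have hrpos : 0 < Real.sqrt (L * D) := Real.sqrt_pos.mpr (by positivity)
  generalize Real.sqrt (L * D) = r at ha hr hrpos
  have ha' : a = 3 * (9 * Real.sqrt 2 * s ^ 2 * (s ^ 2 - 2 * Λ) * r + 8 * s * L * D)
      / (4 * (9 * s ^ 2 + 8 * L) * D) := by
    rw [ha]; congr 1; rw [hD]; ring
  obtain ⟨b0, hb0⟩ : ∃ b0, b0 = 3 * s ^ 2 * Real.sqrt 2 * r / (4 * D) := ⟨_, rfl⟩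
  have hb0pos : 0 < b0 := by rw [hb0]; positivity
  obtain ⟨E, Q⟩ := kato_core s L Λ D _ r a b0 hs hL hD hDpos hq hr ha' hb0
  have hbb : b = b0 := by
    have h2 : 18 * s ^ 2 * a ^ 2 - (16 * a ^ 2 - 24 * s * a + 9 * s ^ 2) * -L
        = (2 * s ^ 2) * (3 * b0) ^ 2 := by
      rw [mul_pow, Q]; field_simp; ring
    have h3 : 0 < Real.sqrt (2 * s ^ 2) := Real.sqrt_pos.mpr (by positivity)
    rw [hb, h2, Real.sqrt_mul (by positivity), Real.sqrt_sq (by positivity)]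
    field_simp
  rw [hbb]
  clear hb hbb ha ha' hb0
  obtain ⟨c, hc⟩ : ∃ c, c = 2 * Λ / s ^ 2 - 1 := ⟨_, rfl⟩
  rw [← hc] at E ⊢
  have hc2 : 0 < 1 - c ^ 2 := by
    have : 1 - c ^ 2 = 4 * (Λ * (s ^ 2 - Λ)) / s ^ 4 := by rw [hc]; field_simp; ring
    rw [this]; positivity
  have hu : 1 - 4 * a / (3 * s) ≠ 0 := by
    intro h
    rw [h] at E Q
    have e : a = -c * b0 := by linarith
    rw [e] at Q
    nlinarith [mul_pos hc2 (pow_pos hb0pos 2)]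
  refine ⟨⟨hb0pos, ?_, ?_⟩, ?_⟩
  · refine abs_le_of_sq_le_sq ?_ hb0pos.le
    rw [Q]; nlinarith [sq_nonneg (1 - 4 * a / (3 * s))]
  · have : -2 * (b0 ^ 2 - a ^ 2) / (1 - 4 * a / (3 * s)) ^ 2 = Real.log ε := by
      rw [hlogL, div_eq_iff (pow_ne_zero 2 hu), Q]; ring
    rw [this, Real.exp_log hε0]
  · intro a' b' hb' _ hexp
    have hlog' := congrArg Real.log hexp
    rw [Real.log_exp, hlogL] at hlog'
    have hu' : 1 - 4 * a' / (3 * s) ≠ 0 := by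
      intro h
      rw [h] at hlog'
      norm_num at hlog'
      linarith
    rw [div_eq_iff (pow_ne_zero 2 hu')] at hlog'
    obtain ⟨u, hudef⟩ : ∃ u, u = 1 - 4 * a / (3 * s) := ⟨_, rfl⟩
    obtain ⟨u', hudef'⟩ : ∃ u', u' = 1 - 4 * a' / (3 * s) := ⟨_, rfl⟩
    rw [← hudef] at E Q
    rw [← hudef'] at hlog'
    have Q' : b' ^ 2 = a' ^ 2 + L / 2 * u' ^ 2 := by linarith
    have CS : a * a' + L / 2 * (u * u') ≤ b0 * b' := by
      refine le_of_abs_le (abs_le_of_sq_le_sq ?_ (by positivity))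
      rw [mul_pow, Q, Q']
      nlinarith [mul_nonneg hL.le (sq_nonneg (a * u' - a' * u))]
    have hlin : a * a' + L / 2 * (u * u') = b0 ^ 2 - c * b0 * (a' - a) := by
      have h1 : u' = u - 4 * (a' - a) / (3 * s) := by rw [hudef, hudef']; ring
      have h2 : a * a' + L / 2 * (u * u')
          = (a ^ 2 + L / 2 * u ^ 2) + (a' - a) * (a - 2 * L / (3 * s) * u) := by
        rw [h1]; ring
      rw [h2, E, ← Q]; ring
    have hfin : b0 - c * (a' - a) ≤ b' := by
      have : b0 * (b0 - c * (a' - a)) ≤ b0 * b' := by linarith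
      exact le_of_mul_le_mul_left this hb0pos
    apply mul_le_mul_of_nonneg_right _ hs.le
    linarith
end

section
/- Optimal parameters for the direct Kato upper bound: Let N ∈ ℕ, ε ∈ (0,1), and Λ̃ ∈ (0,N) be a guess. Then the pair (a,b) with a = 3{9√2·N(N − 2Λ̃)·√(−ln ε·[9Λ̃(N − Λ̃) − 2N ln ε]) − 16N^{3/2} ln²ε + 72Λ̃√N(N − Λ̃) ln ε} / (4(9N − 8 ln ε)[9Λ̃(N − Λ̃) − 2N ln ε]) and b = √(18Na² − (16a² + 24√N·a + 9N) ln ε) / (3√(2N)) minimizes the objective [b + a(2Λ̃/N − 1)]√N over all (a,b) ∈ ℝ × ℝ⁺ satisfying exp[−2(b² − a²)/(1 + 4a/(3√N))²] = ε and b ≥ |a|. -/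
lemma kato_feas_iff (ε t x y : ℝ) (h0 : 0 < ε) (h1 : ε < 1) :
    Real.exp (-2 * (y ^ 2 - x ^ 2) / (1 + t * x) ^ 2) = ε ↔
      (1 + t * x ≠ 0 ∧ y ^ 2 = x ^ 2 + (-Real.log ε / 2) * (1 + t * x) ^ 2) := by
  constructor
  · intro h
    have hne : 1 + t * x ≠ 0 := by
      intro h2
      rw [h2] at h
      norm_num at h
      linarith
    refine ⟨hne, ?_⟩
    have h3 := congrArg Real.log h
    rw [Real.log_exp, div_eq_iff (pow_ne_zero 2 hne)] at h3
    linarith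
  · rintro ⟨hne, h⟩
    have h3 : -2 * (y ^ 2 - x ^ 2) / (1 + t * x) ^ 2 = Real.log ε := by
      rw [div_eq_iff (pow_ne_zero 2 hne)]
      linarith
    rw [h3, Real.exp_log h0]

lemma kato_hyperbola (t p c r a : ℝ) (hp : 0 < p)
    (hr2 : r ^ 2 * (1 + p * t ^ 2 - c ^ 2) = p)
    (ha : a * (1 + p * t ^ 2) = -(p * t + c * r)) :
    r ^ 2 = a ^ 2 + p * (1 + t * a) ^ 2 := by
  have hA : 0 < 1 + p * t ^ 2 := by positivity
  apply mul_left_cancel₀ hA.ne'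
  have e : (1 + p * t ^ 2) * (a ^ 2 + p * (1 + t * a) ^ 2)
      = (a * (1 + p * t ^ 2) + p * t) ^ 2 + p := by ring
  rw [e, ha]
  linear_combination hr2

lemma kato_min (t p c r a x y : ℝ) (hp : 0 < p) (hr : 0 < r) (hy : 0 < y)
    (hr2 : r ^ 2 = a ^ 2 + p * (1 + t * a) ^ 2)
    (ha : a * (1 + p * t ^ 2) = -(p * t + c * r))
    (h : y ^ 2 = x ^ 2 + p * (1 + t * x) ^ 2) :
    r + a * c ≤ y + x * c := by
  have hcs : a * x + p * (1 + t * a) * (1 + t * x) ≤ r * y := by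
    refine (le_abs_self _).trans (abs_le_of_sq_le_sq ?_ (by positivity))
    rw [mul_pow, hr2, h]
    have : 0 ≤ p * (a * (1 + t * x) - x * (1 + t * a)) ^ 2 := by positivity
    nlinarith
  have e1 : a * x + p * (1 + t * a) * (1 + t * x) = -(c * r * x) + p * (1 + t * a) := by
    linear_combination x * ha
  have e2 : p * (1 + t * a) = r ^ 2 + c * r * a := by
    linear_combination - hr2 - a * ha
  have : r * (r + a * c) ≤ r * (y + x * c) := by nlinarith
  exact le_of_mul_le_mul_left this hr

/-- Optimal parameters for the direct Kato upper bound (Eqs. (37)-(38) of the paper):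
for `N ∈ ℕ`, `ε ∈ (0,1)` and a guess `Λ̃ ∈ (0,N)`, the explicitly given pair `(a,b)`
is feasible for the constraint `exp(-2(b² - a²)/(1 + 4a/(3√N))²) = ε`, `b ≥ |a|`,
`b > 0`, and minimizes the deviation term `(b + a(2Λ̃/N - 1))√N` among all feasible
pairs. -/
theorem direct_kato_upper_optimal_parameters
    (N : ℕ) (hN : 0 < N) (ε : ℝ) (hε : ε ∈ Set.Ioo (0 : ℝ) 1)
    (Λ : ℝ) (hΛ : Λ ∈ Set.Ioo (0 : ℝ) (N : ℝ)) (a b : ℝ)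
    (ha : a = 3 * (9 * Real.sqrt 2 * (N : ℝ) * ((N : ℝ) - 2 * Λ) *
          Real.sqrt (-Real.log ε * (9 * Λ * ((N : ℝ) - Λ) - 2 * (N : ℝ) * Real.log ε))
        - 16 * Real.sqrt (N : ℝ) ^ 3 * Real.log ε ^ 2
        + 72 * Λ * Real.sqrt (N : ℝ) * ((N : ℝ) - Λ) * Real.log ε)
      / (4 * (9 * (N : ℝ) - 8 * Real.log ε) *
          (9 * Λ * ((N : ℝ) - Λ) - 2 * (N : ℝ) * Real.log ε)))
    (hb : b = Real.sqrt (18 * (N : ℝ) * a ^ 2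
          - (16 * a ^ 2 + 24 * Real.sqrt (N : ℝ) * a + 9 * (N : ℝ)) * Real.log ε)
      / (3 * Real.sqrt (2 * (N : ℝ)))) :
    (0 < b ∧ b ≥ |a| ∧
      Real.exp (-2 * (b ^ 2 - a ^ 2) / (1 + 4 * a / (3 * Real.sqrt (N : ℝ))) ^ 2) = ε) ∧
    ∀ a' b' : ℝ, 0 < b' → b' ≥ |a'| →
      Real.exp (-2 * (b' ^ 2 - a' ^ 2) / (1 + 4 * a' / (3 * Real.sqrt (N : ℝ))) ^ 2) = ε →
      (b + a * (2 * Λ / (N : ℝ) - 1)) * Real.sqrt (N : ℝ)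
        ≤ (b' + a' * (2 * Λ / (N : ℝ) - 1)) * Real.sqrt (N : ℝ) := by
  obtain ⟨h0, h1⟩ := hε
  obtain ⟨hΛ0, hΛN⟩ := hΛ
  have hn : (0 : ℝ) < N := by exact_mod_cast hN
  have hl : Real.log ε < 0 := Real.log_neg h0 h1
  have hfe := fun t x y => kato_feas_iff ε t x y h0 h1
  generalize (N : ℝ) = n at *
  obtain ⟨L, hL⟩ : ∃ L, L = -Real.log ε := ⟨_, rfl⟩
  have hL' : Real.log ε = -L := by linarith
  rw [hL'] at ha hb hl
  have hLp : 0 < L := by linarith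
  have hs : 0 < Real.sqrt n := Real.sqrt_pos.2 hn
  have hss : Real.sqrt n ^ 2 = n := Real.sq_sqrt hn.le
  generalize Real.sqrt n = s at *
  have hq : 0 < Real.sqrt 2 := by positivity
  have hqq : Real.sqrt 2 ^ 2 = 2 := Real.sq_sqrt (by norm_num)
  generalize Real.sqrt 2 = q at *
  obtain ⟨Q, hQ⟩ : ∃ Q, Q = 9 * Λ * (n - Λ) + 2 * n * L := ⟨_, rfl⟩
  have hQp : 0 < Q := by
    have : 0 < n - Λ := by linarith
    rw [hQ]; positivity
  have hQ' : 9 * Λ * (n - Λ) - 2 * n * -L = Q := by rw [hQ]; ring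
  rw [hQ', neg_neg] at ha
  have hS : 0 < Real.sqrt (L * Q) := by positivity
  have hSS : Real.sqrt (L * Q) ^ 2 = L * Q := Real.sq_sqrt (by positivity)
  generalize Real.sqrt (L * Q) = S at *
  obtain ⟨t, ht⟩ : ∃ t, t = 4 / (3 * s) := ⟨_, rfl⟩
  have htp : 0 < t := by rw [ht]; positivity
  have ht2 : t ^ 2 * n = 16 / 9 := by
    rw [ht, ← hss]; field_simp; norm_num
  have hts : t * s = 4 / 3 := by
    rw [ht]; field_simp
  obtain ⟨c, hc⟩ : ∃ c, c = 2 * Λ / n - 1 := ⟨_, rfl⟩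
  have hcn : c * n = 2 * Λ - n := by rw [hc]; field_simp
  have hc1 : c < 1 := by
    rw [hc, sub_lt_iff_lt_add, div_lt_iff₀ hn]; linarith
  have hp : 0 < L / 2 := by positivity
  obtain ⟨r, hr⟩ : ∃ r, r = 3 * n * q * S / (4 * Q) := ⟨_, rfl⟩
  have hrp : 0 < r := by rw [hr]; positivity
  have hrQ : r * (4 * Q) = 3 * n * q * S := by rw [hr]; field_simp
  have hrr : r ^ 2 * (8 * Q) = 9 * n ^ 2 * L := by
    apply mul_left_cancel₀ hQp.ne'
    have : r ^ 2 * (4 * Q) ^ 2 = 9 * n ^ 2 * q ^ 2 * S ^ 2 := by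
      rw [← mul_pow, hrQ]; ring
    rw [hqq, hSS] at this
    linarith
  have hAc : (1 + L / 2 * t ^ 2 - c ^ 2) * (9 * n ^ 2) = 4 * Q := by
    rw [hQ]
    linear_combination 9 * n * L / 2 * ht2 - 9 * (c * n + (2 * Λ - n)) * hcn
  have hr2 : r ^ 2 * (1 + L / 2 * t ^ 2 - c ^ 2) = L / 2 := by
    have : (9 * n ^ 2) ≠ 0 := by positivity
    apply mul_right_cancel₀ this
    linear_combination r ^ 2 * hAc + hrr / 2
  have haA : a * (1 + L / 2 * t ^ 2) = -(L / 2 * t + c * r) := by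
    have hD : 0 < 9 * n + 8 * L := by positivity
    have h3 : a * (4 * (9 * n + 8 * L) * Q) = 3 * (9 * q * n * (n - 2 * Λ) * S - 8 * s * L * Q) := by
      have h4 : 4 * (9 * n - 8 * -L) * Q ≠ 0 := by
        have : 9 * n - 8 * -L = 9 * n + 8 * L := by ring
        rw [this]; positivity
      rw [eq_div_iff h4] at ha
      have h5 : s ^ 3 = s * n := by rw [← hss]; ring
      rw [h5] at ha
      linear_combination ha + 24 * s * L * hQ
    have hn4 : 4 * Q * (9 * n) ≠ 0 := by positivity
    have hst : s = t * n * (3 / 4) := by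
      linear_combination (t * 3 / 4) * hss - (s * 3 / 4) * hts
    apply mul_right_cancel₀ hn4
    rw [hst] at h3
    linear_combination h3 + 18 * a * L * Q * ht2 + 9 * c * n * hrQ + 9 * (3 * q * n * S) * hcn
  have hhyp := kato_hyperbola t (L / 2) c r a hp hr2 haA
  have hbr : b = r := by
    have h5 : 18 * n * a ^ 2 - (16 * a ^ 2 + 24 * s * a + 9 * n) * -L = (2 * n) * (3 * r) ^ 2 := by
      have hst : s = t * n * (3 / 4) := by
        linear_combination (t * 3 / 4) * hss - (s * 3 / 4) * hts
      rw [hst]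
      linear_combination -18 * n * hhyp - 9 * a ^ 2 * L * ht2
    rw [hb, h5, Real.sqrt_mul (by positivity), Real.sqrt_sq (by positivity)]
    have : 0 < Real.sqrt (2 * n) := by positivity
    field_simp
  have hform : ∀ x, 4 * x / (3 * s) = t * x := by
    intro x; rw [ht]; ring
  have hL2 : -Real.log ε / 2 = L / 2 := by rw [hL]
  subst hbr
  simp only [hform, hfe, ← hc, hL2]
  refine ⟨⟨hrp, ?_, ?_, hhyp⟩, ?_⟩
  · refine abs_le_of_sq_le_sq ?_ hrp.le
    have : 0 ≤ L / 2 * (1 + t * a) ^ 2 := by positivity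
    linarith
  · intro hz
    rw [hz] at hhyp
    have hta : t * a = -1 := by linarith
    have h6 : (t * b) ^ 2 = 1 := by
      linear_combination t ^ 2 * hhyp + (t * a - 1) * hta
    have h7 : t * b = 1 := by
      have : 0 < t * b := by positivity
      exact (sq_eq_sq₀ this.le zero_le_one).1 (by rw [h6]; norm_num)
    have : c = 1 := by
      linear_combination t * haA - hta * (1 + L / 2 * t ^ 2) - c * h7
    linarith
  · rintro x y hy - ⟨-, h⟩
    exact mul_le_mul_of_nonneg_right (kato_min t (L / 2) c b a x y hp hrp hy hhyp haA h) hs.le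
end

section
/- Normalization of the passive-source distribution: For any μ > 0, letting f(θ,I) = 1/(2μπ²·√(1 − (I/(2μ))·cos²(θ/2))·√(1 − (I/(2μ))·sin²(θ/2))) and I*_θ = min{2μ/cos²(θ/2), 2μ/sin²(θ/2)}, it holds that (1/(2π))·∫_{−π}^{π} dφ ∫_0^{π} dθ ∫_0^{I*_θ} f(θ,I) dI = 1. -/
open MeasureTheory intervalIntegral

lemma inner_aux (c s μ : ℝ) (hμ : 0 < μ) (hs : 0 < s) (hsc : s < c) :
    ∫ I in (0 : ℝ)..(2 * μ / c ^ 2),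
            1 / (2 * μ * Real.pi ^ 2 *
                Real.sqrt (1 - I / (2 * μ) * c ^ 2) *
                Real.sqrt (1 - I / (2 * μ) * s ^ 2))
      = 1 / (Real.pi ^ 2 * (s * c)) * (Real.log (c + s) - Real.log (c - s)) := by
  have hc : 0 < c := hs.trans hsc
  have hpi := Real.pi_pos
  have hX : 0 < 2 * μ / c ^ 2 := by positivity
  have hB : ∀ x ∈ Set.Icc 0 (2 * μ / c ^ 2), 0 < 1 - x / (2 * μ) * s ^ 2 := by
    intro x hx
    have h1 : x * c ^ 2 ≤ 2 * μ := by
      have := hx.2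
      rwa [le_div_iff₀ (by positivity)] at this
    have h2 : x * s ^ 2 < 2 * μ := by
      rcases hx.1.eq_or_lt with h | h
      · rw [← h]; linarith
      · have : s ^ 2 < c ^ 2 := by nlinarith
        nlinarith
    have : x / (2 * μ) * s ^ 2 < 1 := by
      rw [div_mul_eq_mul_div, div_lt_one (by positivity)]; exact h2
    linarith
  have hA : ∀ x ∈ Set.Ioo 0 (2 * μ / c ^ 2), 0 < 1 - x / (2 * μ) * c ^ 2 := by
    intro x hx
    have h1 : x * c ^ 2 < 2 * μ := by
      have := hx.2
      rwa [lt_div_iff₀ (by positivity)] at this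
    have : x / (2 * μ) * c ^ 2 < 1 := by
      rw [div_mul_eq_mul_div, div_lt_one (by positivity)]; exact h1
    linarith
  set G : ℝ → ℝ := fun x => -(2 / (s * c * Real.pi ^ 2)) *
    Real.log (c * Real.sqrt (1 - x / (2 * μ) * s ^ 2) + s * Real.sqrt (1 - x / (2 * μ) * c ^ 2))
    with hG
  have hpos : ∀ x ∈ Set.Icc 0 (2 * μ / c ^ 2),
      0 < c * Real.sqrt (1 - x / (2 * μ) * s ^ 2) + s * Real.sqrt (1 - x / (2 * μ) * c ^ 2) := by
    intro x hx
    have := Real.sqrt_pos.2 (hB x hx)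
    positivity
  have hcont : ContinuousOn G (Set.Icc 0 (2 * μ / c ^ 2)) := by
    apply ContinuousOn.mul continuousOn_const
    apply ContinuousOn.log
    · fun_prop
    · intro x hx; exact (hpos x hx).ne'
  have hder : ∀ x ∈ Set.Ioo 0 (2 * μ / c ^ 2), HasDerivAt G (1 / (2 * μ * Real.pi ^ 2 *
                Real.sqrt (1 - x / (2 * μ) * c ^ 2) *
                Real.sqrt (1 - x / (2 * μ) * s ^ 2))) x := by
    intro x hx
    have hb := hB x (Set.Ioo_subset_Icc_self hx)
    have ha := hA x hx
    have hp := hpos x (Set.Ioo_subset_Icc_self hx)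
    have hl : ∀ k : ℝ, HasDerivAt (fun x : ℝ => 1 - x / (2 * μ) * k ^ 2) (-(1 / (2 * μ) * k ^ 2)) x :=
      fun k => (((hasDerivAt_id x).div_const (2 * μ)).mul_const (k ^ 2)).const_sub 1
    have h := (((((hl s).sqrt hb.ne').const_mul c).add
      (((hl c).sqrt ha.ne').const_mul s)).log hp.ne').const_mul (-(2 / (s * c * Real.pi ^ 2)))
    refine h.congr_deriv ?_
    simp only [Pi.add_apply]
    have hb' := Real.sqrt_pos.2 hb
    have ha' := Real.sqrt_pos.2 ha
    generalize Real.sqrt (1 - x / (2 * μ) * s ^ 2) = b at *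
    generalize Real.sqrt (1 - x / (2 * μ) * c ^ 2) = a at *
    field_simp
    try ring
  have hint : IntervalIntegrable (fun x => 1 / (2 * μ * Real.pi ^ 2 *
                Real.sqrt (1 - x / (2 * μ) * c ^ 2) *
                Real.sqrt (1 - x / (2 * μ) * s ^ 2))) volume 0 (2 * μ / c ^ 2) := by
    rw [intervalIntegrable_iff_integrableOn_Ioc_of_le hX.le]
    exact integrableOn_deriv_of_nonneg hcont hder (fun x hx => by positivity)
  rw [integral_eq_sub_of_hasDerivAt_of_le hX.le hcont hder hint]
  simp only [hG]
  have e1 : 1 - 2 * μ / c ^ 2 / (2 * μ) * c ^ 2 = 0 := by field_simp; ring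
  have e2 : c * Real.sqrt (1 - 2 * μ / c ^ 2 / (2 * μ) * s ^ 2) = Real.sqrt ((c + s) * (c - s)) := by
    nth_rewrite 1 [← Real.sqrt_sq hc.le]
    rw [← Real.sqrt_mul (by positivity)]
    congr 1
    field_simp
    ring
  rw [e1, e2]
  simp only [Real.sqrt_zero, mul_zero, add_zero, zero_div, zero_mul, sub_zero, Real.sqrt_one, mul_one]
  rw [Real.log_sqrt (by nlinarith), Real.log_mul (by linarith) (by linarith)]
  field_simp
  ring

lemma odd_sum : HasSum (fun k : ℕ => 1 / (2 * (k : ℝ) + 1) ^ 2) (Real.pi ^ 2 / 8) := by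
  have h := hasSum_zeta_two
  have he : HasSum (fun k : ℕ => 1 / ((2 * k : ℕ) : ℝ) ^ 2) (1 / 4 * (Real.pi ^ 2 / 6)) := by
    have h4 := h.mul_left (1 / 4 : ℝ)
    have e : (fun k : ℕ => 1 / ((2 * k : ℕ) : ℝ) ^ 2) = fun k : ℕ => 1 / 4 * (1 / (k : ℝ) ^ 2) := by
      funext k
      push_cast
      rw [mul_pow, ← one_div_mul_one_div]; norm_num
    rw [e]; exact h4
  have ho : Summable (fun k : ℕ => 1 / ((2 * k + 1 : ℕ) : ℝ) ^ 2) :=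
    h.summable.comp_injective (i := fun k : ℕ => 2 * k + 1) (fun a b hab => by simpa using hab)
  have := (he.even_add_odd (f := fun n : ℕ => 1 / (n : ℝ) ^ 2) ho.hasSum).unique h
  have h3 := ho.hasSum
  rw [show (∑' k : ℕ, 1 / ((2 * k + 1 : ℕ) : ℝ) ^ 2) = Real.pi ^ 2 / 8 by linarith] at h3
  convert h3 using 2 with k
  push_cast; rfl

lemma half_aux : ∫ θ in (0 : ℝ)..(Real.pi / 2),
    1 / (Real.pi ^ 2 * (Real.sin (θ / 2) * Real.cos (θ / 2))) *
     (Real.log (Real.cos (θ / 2) + Real.sin (θ / 2)) -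
       Real.log (Real.cos (θ / 2) - Real.sin (θ / 2))) = 1 / 2 := by
  have hpi := Real.pi_pos
  have hle : (0 : ℝ) ≤ Real.pi / 2 := by positivity
  set F : ℕ → ℝ → ℝ := fun k θ => 4 / Real.pi ^ 2 * (1 / (2 * (k : ℝ) + 1) ^ 2) *
    ((2 * k + 1) * Real.tan (θ / 2) ^ (2 * k) * (1 / Real.cos (θ / 2) ^ 2 * (1 / 2))) with hF
  have hcos : ∀ θ ∈ Set.Icc 0 (Real.pi / 2), 0 < Real.cos (θ / 2) := fun θ hθ =>
    Real.cos_pos_of_mem_Ioo ⟨by linarith [hθ.1], by linarith [hθ.2]⟩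
  have hder : ∀ k : ℕ, ∀ θ ∈ Set.Icc 0 (Real.pi / 2),
      HasDerivAt (fun θ => 4 / Real.pi ^ 2 * (1 / (2 * (k : ℝ) + 1) ^ 2) *
        Real.tan (θ / 2) ^ (2 * k + 1)) (F k θ) θ := by
    intro k θ hθ
    have h1 : HasDerivAt (fun θ : ℝ => Real.tan (θ / 2)) (1 / Real.cos (θ / 2) ^ 2 * (1 / 2)) θ :=
      HasDerivAt.comp (h₂ := Real.tan) (h := fun θ : ℝ => θ / 2) θ
        (Real.hasDerivAt_tan (hcos θ hθ).ne') ((hasDerivAt_id θ).div_const 2)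
    refine ((h1.pow (2 * k + 1)).const_mul _).congr_deriv ?_
    simp only [hF]; push_cast; simp
  have hFc : ∀ k, IntervalIntegrable (F k) volume 0 (Real.pi / 2) := by
    intro k
    apply ContinuousOn.intervalIntegrable
    rw [Set.uIcc_of_le hle]
    have ht : ContinuousOn (fun θ : ℝ => Real.tan (θ / 2)) (Set.Icc 0 (Real.pi / 2)) := by
      intro θ hθ
      exact (HasDerivAt.comp (h₂ := Real.tan) (h := fun θ : ℝ => θ / 2) θ
        (Real.hasDerivAt_tan (hcos θ hθ).ne')
        ((hasDerivAt_id θ).div_const 2)).continuousAt.continuousWithinAt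
    apply ContinuousOn.mul continuousOn_const
    apply ContinuousOn.mul (continuousOn_const.mul (ht.pow _))
    apply ContinuousOn.mul _ continuousOn_const
    apply ContinuousOn.div continuousOn_const (by fun_prop)
    intro θ hθ; exact (pow_pos (hcos θ hθ) 2).ne'
  have hFi : ∀ k, ∫ θ in (0 : ℝ)..(Real.pi / 2), F k θ
      = 4 / Real.pi ^ 2 * (1 / (2 * (k : ℝ) + 1) ^ 2) := by
    intro k
    rw [integral_eq_sub_of_hasDerivAt (fun θ hθ => hder k θ (by rwa [Set.uIcc_of_le hle] at hθ))
      (hFc k)]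
    rw [show Real.pi / 2 / 2 = Real.pi / 4 by ring, Real.tan_pi_div_four]
    simp
  have hF0 : ∀ k θ, 0 ≤ F k θ := by
    intro k θ
    have : 0 ≤ Real.tan (θ / 2) ^ (2 * k) := by rw [pow_mul]; positivity
    simp only [hF]; positivity
  have hsum := odd_sum.mul_left (4 / Real.pi ^ 2)
  have key := hasSum_integral_of_summable_integral_norm
    (μ := volume.restrict (Set.Ioc 0 (Real.pi / 2))) (F := F)
    (fun k => (intervalIntegrable_iff_integrableOn_Ioc_of_le hle).1 (hFc k)) (by
      refine hsum.summable.congr ?_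
      intro k
      rw [← hFi k, integral_of_le hle]
      simp only [Real.norm_of_nonneg (hF0 k _)])
  simp only [← integral_of_le hle, hFi] at key
  have e := key.unique hsum
  rw [show 4 / Real.pi ^ 2 * (Real.pi ^ 2 / 8) = 1 / 2 by field_simp; norm_num] at e
  rw [← e]
  rw [integral_of_le hle, integral_of_le hle, integral_Ioc_eq_integral_Ioo,
    integral_Ioc_eq_integral_Ioo]
  apply setIntegral_congr_fun measurableSet_Ioo
  intro θ hθ
  have hc := hcos θ (Set.Ioo_subset_Icc_self hθ)
  have hs : 0 < Real.sin (θ / 2) :=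
    Real.sin_pos_of_pos_of_lt_pi (by linarith [hθ.1]) (by linarith [hθ.2])
  have hsc : Real.sin (θ / 2) < Real.cos (θ / 2) := by
    rw [← Real.cos_pi_div_two_sub]
    apply Real.cos_lt_cos_of_nonneg_of_le_pi <;> linarith [hθ.1, hθ.2]
  have ht : Real.tan (θ / 2) = Real.sin (θ / 2) / Real.cos (θ / 2) := Real.tan_eq_sin_div_cos _
  have ht0 : 0 < Real.tan (θ / 2) := by rw [ht]; positivity
  have ht1 : Real.tan (θ / 2) < 1 := by rw [ht, div_lt_one hc]; exact hsc
  have hl := Real.hasSum_log_sub_log_of_abs_lt_one (x := Real.tan (θ / 2))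
    (by rw [abs_of_pos ht0]; exact ht1)
  have hl2 := hl.mul_left (1 / (Real.pi ^ 2 * (Real.sin (θ / 2) * Real.cos (θ / 2))))
  have e1 : Real.log (Real.cos (θ / 2) + Real.sin (θ / 2)) -
       Real.log (Real.cos (θ / 2) - Real.sin (θ / 2)) =
       Real.log (1 + Real.tan (θ / 2)) - Real.log (1 - Real.tan (θ / 2)) := by
    have a1 : Real.cos (θ / 2) + Real.sin (θ / 2) = Real.cos (θ / 2) * (1 + Real.tan (θ / 2)) := by
      rw [ht]; field_simp
    have a2 : Real.cos (θ / 2) - Real.sin (θ / 2) = Real.cos (θ / 2) * (1 - Real.tan (θ / 2)) := by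
      rw [ht]; field_simp
    rw [a1, a2, Real.log_mul hc.ne' (by linarith), Real.log_mul hc.ne' (by linarith)]
    ring
  simp only
  rw [e1, ← hl2.tsum_eq]
  congr 1
  funext k
  simp only [hF]
  have hk : (0 : ℝ) < 2 * k + 1 := by positivity
  rw [pow_succ]
  have hs_eq : Real.sin (θ / 2) = Real.tan (θ / 2) * Real.cos (θ / 2) := by
    rw [ht]; field_simp
  rw [hs_eq]
  field_simp
  try ring

/-- Normalization of the passive-source distribution (Eqs. (2)-(3) of the paper):
for any mean intensity `μ = νt > 0`, the joint density `f(θ,I)` of the polar angle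
`θ` and output intensity `I`, with `φ` uniform on `(−π,π]` and
`I*_θ = min{2μ/cos²(θ/2), 2μ/sin²(θ/2)}`, integrates to one:
`(1/2π) ∫_{−π}^{π} dφ ∫_0^π dθ ∫_0^{I*_θ} f(θ,I) dI = 1`. -/
theorem passive_source_normalization (μ : ℝ) (hμ : 0 < μ) :
    (1 / (2 * Real.pi)) *
      ∫ φ in (-Real.pi)..Real.pi,
        ∫ θ in (0 : ℝ)..Real.pi,
          ∫ I in (0 : ℝ)..(min (2 * μ / Real.cos (θ / 2) ^ 2)
              (2 * μ / Real.sin (θ / 2) ^ 2)),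
            1 / (2 * μ * Real.pi ^ 2 *
                Real.sqrt (1 - I / (2 * μ) * Real.cos (θ / 2) ^ 2) *
                Real.sqrt (1 - I / (2 * μ) * Real.sin (θ / 2) ^ 2)) = 1 := by
  have hpi := Real.pi_pos
  have hle : (0 : ℝ) ≤ Real.pi / 2 := by positivity
  set H : ℝ → ℝ := fun θ => ∫ I in (0 : ℝ)..(min (2 * μ / Real.cos (θ / 2) ^ 2)
              (2 * μ / Real.sin (θ / 2) ^ 2)),
            1 / (2 * μ * Real.pi ^ 2 *
                Real.sqrt (1 - I / (2 * μ) * Real.cos (θ / 2) ^ 2) *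
                Real.sqrt (1 - I / (2 * μ) * Real.sin (θ / 2) ^ 2)) with hH
  have hsymm : ∀ θ, H (Real.pi - θ) = H θ := by
    intro θ
    simp only [hH]
    rw [show (Real.pi - θ) / 2 = Real.pi / 2 - θ / 2 by ring, Real.cos_pi_div_two_sub,
      Real.sin_pi_div_two_sub, min_comm]
    congr 1
    funext I
    rw [mul_right_comm]
  have h1 : ∫ θ in (0 : ℝ)..(Real.pi / 2), H θ = 1 / 2 := by
    rw [← half_aux]
    rw [integral_of_le hle, integral_of_le hle, integral_Ioc_eq_integral_Ioo,
      integral_Ioc_eq_integral_Ioo]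
    apply setIntegral_congr_fun measurableSet_Ioo
    intro θ hθ
    have hs : 0 < Real.sin (θ / 2) :=
      Real.sin_pos_of_pos_of_lt_pi (by linarith [hθ.1]) (by linarith [hθ.2])
    have hsc : Real.sin (θ / 2) < Real.cos (θ / 2) := by
      rw [← Real.cos_pi_div_two_sub]
      apply Real.cos_lt_cos_of_nonneg_of_le_pi <;> linarith [hθ.1, hθ.2]
    simp only [hH]
    rw [← inner_aux _ _ μ hμ hs hsc, min_eq_left]
    apply div_le_div_of_nonneg_left (by positivity) (by positivity)
    gcongr
  have h2 : ∫ θ in (Real.pi / 2)..Real.pi, H θ = 1 / 2 := by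
    have := integral_comp_sub_left (a := 0) (b := Real.pi / 2) H Real.pi
    simp only [hsymm] at this
    rw [h1, sub_zero, show Real.pi - Real.pi / 2 = Real.pi / 2 by ring] at this
    exact this.symm
  have hi : ∀ a b : ℝ, ∫ θ in a..b, H θ = 1 / 2 → IntervalIntegrable H volume a b := by
    intro a b hab
    by_contra hn
    rw [intervalIntegral.integral_undef hn] at hab
    norm_num at hab
  have h3 : ∫ θ in (0 : ℝ)..Real.pi, H θ = 1 := by
    rw [← integral_add_adjacent_intervals (hi _ _ h1) (hi _ _ h2), h1, h2]
    norm_num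
  rw [h3, intervalIntegral.integral_const]
  simp only [smul_eq_mul]
  field_simp
  ring
end
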